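/- arXiv:1102.2583 — 2 statements merged into one kernel-verified Lean document; each statement's English description precedes it below -/
import Mathlib

section
/- Let A be the vertex–edge incidence matrix of a finite undirected graph G and let d ∈ ℤ^V. For any two elements x, y of the fiber F_d there exists a finite sequence x = x_0, x_1, …, x_r = y such that each x_k belongs to F_d and each difference x_{k+1} − x_k is a primitive move. (The Graver basis connects all elements of every fiber.) -/
open Matrix

namespace BetaModel

variable {V : Type*}

/-- The vertex–edge incidence matrix of `G` : `A i e = 1` iff vertex `i` is an endpoint of
edge `e`, and `A i e = 0` otherwise. -/
def incidence [DecidableEq V] (G : SimpleGraph V) : Matrix V G.edgeSet ℤ :=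
  fun i e => if i ∈ (e : Sym2 V) then 1 else 0

/-- A move: an integer vector on the edges lying in the kernel of the incidence matrix. -/
def IsMove [Fintype V] [DecidableEq V] (G : SimpleGraph V) [Fintype G.edgeSet]
    (z : G.edgeSet → ℤ) : Prop :=
  incidence G *ᵥ z = 0

/-- The sum `z₁ + z₂` is conformal : there is no cancellation of signs, i.e.
`supp(z₁⁺) ∩ supp(z₂⁻) = supp(z₁⁻) ∩ supp(z₂⁺) = ∅`. -/
def ConformalPair {E : Type*} (z₁ z₂ : E → ℤ) : Prop :=
  ∀ e, (0 < z₁ e → 0 ≤ z₂ e) ∧ (z₁ e < 0 → z₂ e ≤ 0)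

/-- A sum `z_1 + ⋯ + z_r` is conformal : for every edge `e` the nonzero entries among
`z_1 e, …, z_r e` all have the same sign. -/
def ConformalFamily {E : Type*} {r : ℕ} (zs : Fin r → E → ℤ) : Prop :=
  ∀ e, (∀ i, 0 ≤ zs i e) ∨ (∀ i, zs i e ≤ 0)

/-- A primitive move: a nonzero move which cannot be written as a conformal sum of two
nonzero moves. -/
def IsPrimitiveMove [Fintype V] [DecidableEq V] (G : SimpleGraph V) [Fintype G.edgeSet]
    (z : G.edgeSet → ℤ) : Prop :=
  IsMove G z ∧ z ≠ 0 ∧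
    ¬ ∃ z₁ z₂ : G.edgeSet → ℤ, IsMove G z₁ ∧ IsMove G z₂ ∧ z₁ ≠ 0 ∧ z₂ ≠ 0 ∧
      ConformalPair z₁ z₂ ∧ z = z₁ + z₂

/-- The fiber `F_d = {x ∈ ℤ^E_{≥0} : Ax = d}`. -/
def Fiber [Fintype V] [DecidableEq V] (G : SimpleGraph V) [Fintype G.edgeSet]
    (d : V → ℤ) : Set (G.edgeSet → ℤ) :=
  {x | (∀ e, 0 ≤ x e) ∧ incidence G *ᵥ x = d}

/-- A square-free vector: all entries lie in `{-1, 0, 1}`. -/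
def IsSquareFree {E : Type*} (z : E → ℤ) : Prop :=
  ∀ e, z e = -1 ∨ z e = 0 ∨ z e = 1

end BetaModel

open BetaModel

namespace BetaModel

/-- A reflexive-transitive chain can be listed as a finite sequence. -/
lemma exists_fin_seq_of_reflTransGen {α : Type*} {R : α → α → Prop} {a b : α}
    (h : Relation.ReflTransGen R a b) :
    ∃ (r : ℕ) (f : Fin (r + 1) → α), f 0 = a ∧ f (Fin.last r) = b ∧
      ∀ k : Fin r, R (f k.castSucc) (f k.succ) := by
  induction h using Relation.ReflTransGen.head_induction_on with
  | refl => exact ⟨0, fun _ => b, rfl, rfl, fun k => k.elim0⟩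
  | @head a c hac _ ih =>
    obtain ⟨r, f, h0, hl, hf⟩ := ih
    refine ⟨r + 1, Fin.cons a f, rfl, ?_, fun k => ?_⟩
    · rw [← Fin.succ_last, Fin.cons_succ, hl]
    · cases k using Fin.cases with
      | zero => simpa [h0] using hac
      | succ k => simpa [← Fin.succ_castSucc] using hf k

lemma ConformalPair.abs_add {E : Type*} {z₁ z₂ : E → ℤ} (h : ConformalPair z₁ z₂) (e : E) :
    |z₁ e + z₂ e| = |z₁ e| + |z₂ e| := by
  have := h e
  grind

lemma sum_abs_pos {E : Type*} [Fintype E] {z : E → ℤ} (hz : z ≠ 0) : 0 < ∑ e, |z e| := by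
  obtain ⟨e, he⟩ := Function.ne_iff.mp hz
  exact Finset.sum_pos' (fun _ _ => abs_nonneg _) ⟨e, Finset.mem_univ e, abs_pos.mpr he⟩

variable {V : Type*} [Fintype V] [DecidableEq V] {G : SimpleGraph V} [Fintype G.edgeSet]

/-- Adding the first summand of a conformal decomposition of `y - x` to `x` stays in the fiber. -/
lemma add_mem_fiber {d : V → ℤ} {x y z₁ z₂ : G.edgeSet → ℤ} (hx : x ∈ Fiber G d)
    (hy : y ∈ Fiber G d) (hz₁ : IsMove G z₁) (hc : ConformalPair z₁ z₂)
    (hz : y - x = z₁ + z₂) : x + z₁ ∈ Fiber G d := by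
  refine ⟨fun e => ?_, ?_⟩
  · have h₁ := hx.1 e
    have h₂ := hy.1 e
    have h₃ := hc e
    have h₄ := congrFun hz e
    simp only [Pi.add_apply, Pi.sub_apply] at h₄ ⊢
    grind
  · rw [mulVec_add, hx.2, hz₁, add_zero]

lemma reflTransGen_fiber {d : V → ℤ} (n : ℕ) {x y : G.edgeSet → ℤ} (hx : x ∈ Fiber G d)
    (hy : y ∈ Fiber G d) (hn : ∑ e, |(y - x) e| < n) :
    Relation.ReflTransGen
      (fun a b => a ∈ Fiber G d ∧ b ∈ Fiber G d ∧ IsPrimitiveMove G (b - a)) x y := by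
  induction n generalizing x y with
  | zero => exact absurd hn (by simpa using Finset.sum_nonneg fun e _ => abs_nonneg _)
  | succ n ih =>
    by_cases hp : IsPrimitiveMove G (y - x)
    · exact .single ⟨hx, hy, hp⟩
    by_cases h0 : y - x = 0
    · rw [sub_eq_zero.mp h0]
    have hm : IsMove G (y - x) := by rw [IsMove, mulVec_sub, hx.2, hy.2, sub_self]
    obtain ⟨z₁, z₂, hm₁, hm₂, h₁, h₂, hc, hz⟩ := not_not.mp fun h => hp ⟨hm, h0, h⟩
    have hw := add_mem_fiber hx hy hm₁ hc hz
    have hsum : ∑ e, |(y - x) e| = ∑ e, |z₁ e| + ∑ e, |z₂ e| := by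
      rw [hz, ← Finset.sum_add_distrib]
      exact Finset.sum_congr rfl fun e _ => hc.abs_add e
    have hp₁ := sum_abs_pos h₁
    have hp₂ := sum_abs_pos h₂
    push_cast at hn
    refine (ih hx hw ?_).trans (ih hw hy ?_)
    · rw [add_sub_cancel_left]
      linarith
    · rw [← sub_sub, hz, add_sub_cancel_left]
      linarith

end BetaModel

/-- The Graver basis connects all elements of every fiber. -/
theorem graver_connects_fiber
    {V : Type*} [Fintype V] [DecidableEq V] (G : SimpleGraph V) [Fintype G.edgeSet]
    (d : V → ℤ) (x y : G.edgeSet → ℤ) (hx : x ∈ Fiber G d) (hy : y ∈ Fiber G d) :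
    ∃ (r : ℕ) (xs : Fin (r + 1) → G.edgeSet → ℤ),
      xs 0 = x ∧ xs (Fin.last r) = y ∧ (∀ k, xs k ∈ Fiber G d) ∧
      ∀ k : Fin r, IsPrimitiveMove G (xs k.succ - xs k.castSucc) := by
  obtain ⟨r, f, h0, hl, hf⟩ := exists_fin_seq_of_reflTransGen
    (reflTransGen_fiber ((∑ e, |(y - x) e|).toNat + 1) hx hy (by push_cast; omega))
  refine ⟨r, f, h0, hl, fun k => ?_, fun k => (hf k).2.2⟩
  cases k using Fin.cases with
  | zero => rwa [h0]
  | succ k => exact (hf k).2.1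
end

section
/- Let A be the vertex–edge incidence matrix of a finite undirected graph G and let d ∈ ℤ^V. For any two elements x, y of the fiber F_d all of whose entries lie in {0,1}, there exists a finite sequence x = x_0, x_1, …, x_r = y such that each x_k belongs to F_d, each x_k has all entries in {0,1}, and each difference x_{k+1} − x_k is a square-free primitive move. (The square-free elements of the Graver basis connect all elements of every fiber under the restriction to simple graphs.) -/
open Matrix

open BetaModel

namespace BetaModel

section Moves

variable {V : Type*} [Fintype V] [DecidableEq V] {G : SimpleGraph V} [Fintype G.edgeSet]

/-- The difference of two elements of a fiber is a move. -/
theorem isMove_sub_of_mem_fiber {d : V → ℤ} {x y : G.edgeSet → ℤ}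
    (hx : x ∈ Fiber G d) (hy : y ∈ Fiber G d) : IsMove G (y - x) := by
  rw [IsMove, Matrix.mulVec_sub, hx.2, hy.2, sub_self]

/-- The simple graphs in a fiber, that is, its elements with all entries in `{0, 1}`. -/
def simpleFiber (G : SimpleGraph V) [Fintype G.edgeSet] (d : V → ℤ) :
    Set (G.edgeSet → ℤ) :=
  {x | x ∈ Fiber G d ∧ ∀ e, x e = 0 ∨ x e = 1}

/-- Two simple graphs in a fiber that differ by a square-free primitive move. -/
def SquareFreeStep {d : V → ℤ} (x y : simpleFiber G d) : Prop :=
  IsPrimitiveMove G (y.1 - x.1) ∧ IsSquareFree (y.1 - x.1)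

theorem isSquareFree_sub {d : V → ℤ} (x y : simpleFiber G d) :
    IsSquareFree (y.1 - x.1) := by
  intro e
  have := x.2.2 e
  have := y.2.2 e
  simp only [Pi.sub_apply]
  omega

/-- If the difference of two simple graphs in a fiber is a conformal sum of two moves, then
adding the first of these moves gives another simple graph in the fiber. -/
theorem add_mem_simpleFiber {d : V → ℤ} (x y : simpleFiber G d) {z₁ z₂ : G.edgeSet → ℤ}
    (hz₁ : IsMove G z₁) (hc : ConformalPair z₁ z₂) (h : y.1 - x.1 = z₁ + z₂) :
    x.1 + z₁ ∈ simpleFiber G d := by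
  have h01 : ∀ e, (x.1 + z₁) e = 0 ∨ (x.1 + z₁) e = 1 := by
    intro e
    have := x.2.2 e
    have := y.2.2 e
    have := hc e
    have := congrFun h e
    simp only [Pi.sub_apply, Pi.add_apply] at *
    omega
  refine ⟨⟨fun e => ?_, ?_⟩, h01⟩
  · have := h01 e
    omega
  · rw [Matrix.mulVec_add, x.2.1.2, hz₁, add_zero]

theorem sum_natAbs_pos {E : Type*} [Fintype E] {z : E → ℤ} (hz : z ≠ 0) :
    0 < ∑ e, (z e).natAbs := by
  obtain ⟨e, he⟩ := Function.ne_iff.mp hz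
  exact Finset.sum_pos' (fun _ _ => Nat.zero_le _)
    ⟨e, Finset.mem_univ e, Int.natAbs_pos.mpr he⟩

/-- The `ℓ¹` norm is additive on conformal sums. -/
theorem ConformalPair.sum_natAbs_add {E : Type*} [Fintype E] {z₁ z₂ : E → ℤ}
    (hc : ConformalPair z₁ z₂) :
    ∑ e, ((z₁ + z₂) e).natAbs = ∑ e, (z₁ e).natAbs + ∑ e, (z₂ e).natAbs := by
  rw [← Finset.sum_add_distrib]
  refine Finset.sum_congr rfl fun e _ => ?_
  have := hc e
  simp only [Pi.add_apply]
  omega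

theorem reflTransGen_squareFreeStep {d : V → ℤ} (x y : simpleFiber G d) :
    Relation.ReflTransGen SquareFreeStep x y := by
  induction hn : ∑ e, ((y.1 - x.1) e).natAbs using Nat.strong_induction_on
    generalizing x y with
  | _ n ih =>
    by_cases hxy : y.1 - x.1 = 0
    · rw [Subtype.ext (sub_eq_zero.mp hxy)]
    by_cases hp : IsPrimitiveMove G (y.1 - x.1)
    · exact .single ⟨hp, isSquareFree_sub x y⟩
    obtain ⟨z₁, z₂, hz₁, -, hne₁, hne₂, hc, h⟩ : ∃ z₁ z₂ : G.edgeSet → ℤ, IsMove G z₁ ∧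
        IsMove G z₂ ∧ z₁ ≠ 0 ∧ z₂ ≠ 0 ∧ ConformalPair z₁ z₂ ∧ y.1 - x.1 = z₁ + z₂ := by
      by_contra hno
      exact hp ⟨isMove_sub_of_mem_fiber x.2.1 y.2.1, hxy, hno⟩
    let w : simpleFiber G d := ⟨x.1 + z₁, add_mem_simpleFiber x y hz₁ hc h⟩
    have hw₁ : w.1 - x.1 = z₁ := add_sub_cancel_left _ _
    have hw₂ : y.1 - w.1 = z₂ := by
      rw [← sub_sub, h, add_sub_cancel_left]
    have hsum := hc.sum_natAbs_add
    rw [← h, hn] at hsum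
    have hpos₁ := sum_natAbs_pos hne₁
    have hpos₂ := sum_natAbs_pos hne₂
    exact (ih _ (by rw [hw₁]; omega) x w rfl).trans (ih _ (by rw [hw₂]; omega) w y rfl)

end Moves

/-- The reflexive transitive closure is witnessed by finite sequences. -/
theorem exists_fin_chain_of_reflTransGen {α : Type*} {R : α → α → Prop} {x y : α}
    (h : Relation.ReflTransGen R x y) :
    ∃ (r : ℕ) (xs : Fin (r + 1) → α), xs 0 = x ∧ xs (Fin.last r) = y ∧
      ∀ k : Fin r, R (xs k.castSucc) (xs k.succ) := by
  induction h using Relation.ReflTransGen.head_induction_on with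
  | refl => exact ⟨0, fun _ => y, rfl, rfl, fun k => k.elim0⟩
  | @head a b hab _ ih =>
    obtain ⟨r, xs, h0, hlast, hstep⟩ := ih
    refine ⟨r + 1, Fin.cons a xs, rfl, ?_, Fin.cases ?_ fun k => ?_⟩
    · rw [← Fin.succ_last, Fin.cons_succ, hlast]
    · simpa [h0] using hab
    · simpa [← Fin.succ_castSucc] using hstep k

end BetaModel

/-- The square-free elements of the Graver basis connect all 0-1 elements of every fiber. -/
theorem squarefree_graver_connects_simple_fiber
    {V : Type*} [Fintype V] [DecidableEq V] (G : SimpleGraph V) [Fintype G.edgeSet]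
    (d : V → ℤ) (x y : G.edgeSet → ℤ) (hx : x ∈ Fiber G d) (hy : y ∈ Fiber G d)
    (hx01 : ∀ e, x e = 0 ∨ x e = 1) (hy01 : ∀ e, y e = 0 ∨ y e = 1) :
    ∃ (r : ℕ) (xs : Fin (r + 1) → G.edgeSet → ℤ),
      xs 0 = x ∧ xs (Fin.last r) = y ∧
      (∀ k, xs k ∈ Fiber G d) ∧
      (∀ k e, xs k e = 0 ∨ xs k e = 1) ∧
      ∀ k : Fin r, IsPrimitiveMove G (xs k.succ - xs k.castSucc) ∧
        IsSquareFree (xs k.succ - xs k.castSucc) := by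
  obtain ⟨r, xs, h0, hlast, hstep⟩ := exists_fin_chain_of_reflTransGen
    (reflTransGen_squareFreeStep (⟨x, hx, hx01⟩ : simpleFiber G d) ⟨y, hy, hy01⟩)
  exact ⟨r, fun k => (xs k).1, congrArg Subtype.val h0, congrArg Subtype.val hlast,
    fun k => (xs k).2.1, fun k => (xs k).2.2, hstep⟩
end
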